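/- arXiv:2604.13703 — 2 statements merged into one kernel-verified Lean document; each statement's English description precedes it below -/
import Mathlib

section
/- Let λ ≥ 0, η > 1 and D > 4·max{1, λ}/(η² − η). There exists a constant C > 0 such that for every t ≥ 0, every x ∈ ℝ³ and every multi-index α ∈ ℕ³ with |α| ≤ 1, ∫_{ℝ³} |∂_x^α(|x−y|^{−1} e^{−|x−y|})| e^{−(|y|−λt)²/(D(1+t))} dy ≤ C e^{−(|x|−λt)²/(η²D(1+t))} + C e^{−(|x|+t)/(η²D)}. -/
open MeasureTheory Real
open scoped ENNReal

noncomputable section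

abbrev E3 : Type := EuclideanSpace ℝ (Fin 3)

/-- The kernel `z ↦ |z|⁻¹ e^{-|z|}`. -/
def Yk (z : E3) : ℝ := ‖z‖⁻¹ * Real.exp (-‖z‖)

theorem abs_Yk_le (z : E3) : |Yk z| ≤ ((‖z‖ ^ 2)⁻¹ + ‖z‖⁻¹) * Real.exp (-‖z‖) := by
  have h : 0 ≤ Yk z := by unfold Yk; positivity
  rw [abs_of_nonneg h, Yk]
  gcongr
  have : 0 ≤ (‖z‖ ^ 2)⁻¹ := by positivity
  linarith

theorem abs_fderiv_Yk_single_le {z : E3} (hz : z ≠ 0) (i : Fin 3) :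
    |fderiv ℝ Yk z (EuclideanSpace.single i 1)| ≤
      ((‖z‖ ^ 2)⁻¹ + ‖z‖⁻¹) * Real.exp (-‖z‖) := by
  have hr : ‖z‖ ≠ 0 := norm_ne_zero_iff.2 hz
  have hN : DifferentiableAt ℝ (fun w : E3 => ‖w‖) z :=
    (contDiffAt_norm (n := 1) ℝ hz).differentiableAt one_ne_zero
  have hf : HasDerivAt (fun r : ℝ => r⁻¹ * Real.exp (-r))
      (-(((‖z‖ ^ 2)⁻¹ + ‖z‖⁻¹) * Real.exp (-‖z‖))) ‖z‖ := by
    refine ((hasDerivAt_inv hr).mul (hasDerivAt_neg ‖z‖).exp).congr_deriv ?_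
    ring
  have hY : HasFDerivAt Yk (-(((‖z‖ ^ 2)⁻¹ + ‖z‖⁻¹) * Real.exp (-‖z‖)) •
      fderiv ℝ (fun w : E3 => ‖w‖) z) z :=
    hf.comp_hasFDerivAt z hN.hasFDerivAt
  have hle : |fderiv ℝ (fun w : E3 => ‖w‖) z (EuclideanSpace.single i 1)| ≤ 1 := by
    have h1 : ‖fderiv ℝ (fun w : E3 => ‖w‖) z‖ ≤ 1 := by
      simpa using norm_fderiv_le_of_lipschitz ℝ (x₀ := z) (lipschitzWith_one_norm (E := E3))
    have h2 := (fderiv ℝ (fun w : E3 => ‖w‖) z).le_of_opNorm_le h1 (EuclideanSpace.single i 1)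
    simpa using h2
  have hK : 0 ≤ ((‖z‖ ^ 2)⁻¹ + ‖z‖⁻¹) * Real.exp (-‖z‖) := by positivity
  rw [hY.fderiv, smul_apply, smul_eq_mul, abs_mul, abs_neg, abs_of_nonneg hK]
  exact mul_le_of_le_one_right hK hle

theorem integrable_inv_sq_add_inv_mul_exp {δ : ℝ} (hδ : 0 < δ) :
    Integrable (fun z : E3 => ((‖z‖ ^ 2)⁻¹ + ‖z‖⁻¹) * Real.exp (-(δ * ‖z‖))) := by
  refine (integrable_fun_norm_addHaar volume
    (f := fun r : ℝ => ((r ^ 2)⁻¹ + r⁻¹) * Real.exp (-(δ * r)))).2 ?_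
  have h0 : IntegrableOn (fun r : ℝ => Real.exp (-(δ * r))) (Set.Ioi 0) := by
    simpa using integrableOn_rpow_mul_exp_neg_mul_rpow (s := 0) (p := 1) (b := δ)
      (by norm_num) one_pos hδ
  have h1 : IntegrableOn (fun r : ℝ => r * Real.exp (-(δ * r))) (Set.Ioi 0) := by
    simpa using integrableOn_rpow_mul_exp_neg_mul_rpow (s := 1) (p := 1) (b := δ)
      (by norm_num) one_pos hδ
  refine (h0.add h1).congr_fun (fun r hr => ?_) measurableSet_Ioi
  have hr : r ≠ 0 := ne_of_gt hr
  simp only [finrank_euclideanSpace, Fintype.card_fin, Pi.add_apply, smul_eq_mul]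
  field_simp
  ring

/-- Scalar comparison: a Gaussian weight of the form `e^{-b²/T}` against an exponential weight in
`r ≥ |a - b|`, where `a` stands for `|x| - λt` and `b` for `|y| - λt`. -/
theorem exp_neg_mul_exp_le {lam η D κ t p q r : ℝ} (hη : 1 < η) (hD : 0 < D)
    (hκ0 : 0 < κ) (hκ1 : κ < 1) (hκ : κ * ((η ^ 2 - η) * D) = 4 * max 1 lam)
    (ht : 0 ≤ t) (hp : 0 ≤ p) (hr : |p - q| ≤ r) :
    Real.exp (-r) * Real.exp (-(q - lam * t) ^ 2 / (D * (1 + t))) ≤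
      Real.exp (-((1 - κ) * r)) *
        (Real.exp (-(p - lam * t) ^ 2 / (η ^ 2 * D * (1 + t))) +
          Real.exp (-(p + t) / (η ^ 2 * D))) := by
  have hr0 : 0 ≤ r := (abs_nonneg _).trans hr
  have hT : 0 < D * (1 + t) := by positivity
  have hη0 : 0 < η := by linarith
  have hm1 : 1 ≤ max 1 lam := le_max_left _ _
  have hml : lam ≤ max 1 lam := le_max_right _ _
  set m := max 1 lam
  obtain ⟨a, ha⟩ : ∃ a, a = p - lam * t := ⟨_, rfl⟩
  obtain ⟨b, hb⟩ : ∃ b, b = q - lam * t := ⟨_, rfl⟩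
  rw [← ha, ← hb]
  have hab : |a - b| ≤ r := by rw [ha, hb]; simpa using hr
  have hE1 := Real.exp_nonneg (-a ^ 2 / (η ^ 2 * D * (1 + t)))
  have hE2 := Real.exp_nonneg (-(p + t) / (η ^ 2 * D))
  have hb_nonpos : -b ^ 2 / (D * (1 + t)) ≤ 0 :=
    div_nonpos_of_nonpos_of_nonneg (by nlinarith [sq_nonneg b]) hT.le
  suffices h : -(κ * r) + -b ^ 2 / (D * (1 + t)) ≤ -a ^ 2 / (η ^ 2 * D * (1 + t)) ∨
      -(κ * r) + -b ^ 2 / (D * (1 + t)) ≤ -(p + t) / (η ^ 2 * D) by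
    have hsplit : Real.exp (-r) * Real.exp (-b ^ 2 / (D * (1 + t))) =
        Real.exp (-((1 - κ) * r)) * Real.exp (-(κ * r) + -b ^ 2 / (D * (1 + t))) := by
      rw [← Real.exp_add, ← Real.exp_add]; ring_nf
    rw [hsplit]
    refine mul_le_mul_of_nonneg_left ?_ (Real.exp_nonneg _)
    rcases h with h | h
    · linarith [Real.exp_le_exp.2 h]
    · linarith [Real.exp_le_exp.2 h]
  have hκr : 0 ≤ κ * r := by positivity
  by_cases h1 : |a| ≤ η * |b|
  · left
    have h2 : a ^ 2 ≤ η ^ 2 * b ^ 2 := by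
      rw [← sq_abs a, ← sq_abs b, ← mul_pow]
      gcongr
    have h3 : -b ^ 2 / (D * (1 + t)) ≤ -a ^ 2 / (η ^ 2 * D * (1 + t)) := by
      rw [div_le_div_iff₀ hT (by positivity)]
      nlinarith [mul_le_mul_of_nonneg_right h2 hT.le]
    linarith
  push Not at h1
  have hra : (η - 1) * |a| ≤ η * r := by
    have : |a| - |b| ≤ r := (abs_sub_abs_le_abs_sub a b).trans hab
    nlinarith
  have hκa : 4 * m * |a| ≤ κ * r * (η ^ 2 * D) := by
    have h4 := mul_le_mul_of_nonneg_left hra (by positivity : 0 ≤ κ * (η * D))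
    have h5 : 4 * m * |a| = κ * (η * D) * ((η - 1) * |a|) := by rw [← hκ]; ring
    rw [h5]
    linarith
  by_cases h2 : |a| ≤ 4 * m * (1 + t)
  · left
    have h3 : -(κ * r) ≤ -a ^ 2 / (η ^ 2 * D * (1 + t)) := by
      rw [le_div_iff₀ (by positivity), ← sq_abs a]
      have h6 := mul_le_mul_of_nonneg_right hκa (by positivity : 0 ≤ 1 + t)
      nlinarith [mul_le_mul_of_nonneg_left h2 (abs_nonneg a)]
    linarith
  · right
    push Not at h2
    have hlt : lam * t ≤ m * t := mul_le_mul_of_nonneg_right hml ht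
    have htm : t ≤ m * t := le_mul_of_one_le_left ht hm1
    have ha0 : 0 ≤ a := by
      by_contra hneg
      rw [abs_of_neg (not_le.1 hneg)] at h2
      nlinarith
    rw [abs_of_nonneg ha0] at h2 hκa
    have h3 : -(κ * r) ≤ -(p + t) / (η ^ 2 * D) := by
      rw [le_div_iff₀ (by positivity)]
      have : a ≤ m * a := le_mul_of_one_le_left ha0 hm1
      nlinarith
    linarith

/-- For `λ ≥ 0`, `η > 1` and `D > 4 max{1,λ}/(η²-η)` there is `C > 0` such that for every
derivative `∂_x^α` of the kernel `|z|⁻¹ e^{-|z|}` of order `|α| ≤ 1`, all `t ≥ 0`, `x ∈ ℝ³`,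
`∫ |∂_x^α(|x-y|⁻¹ e^{-|x-y|})| e^{-(|y|-λt)²/(D(1+t))} dy
  ≤ C e^{-(|x|-λt)²/(η²D(1+t))} + C e^{-(|x|+t)/(η²D)}`. -/
theorem yukawa_kernel_huygens_conv (lam η D : ℝ) (hlam : 0 ≤ lam) (hη : 1 < η)
    (hD : 4 * max 1 lam / (η ^ 2 - η) < D) :
    ∃ C > (0 : ℝ), ∀ g : E3 → ℝ,
      (g = Yk ∨ ∃ i : Fin 3, g = fun z => fderiv ℝ Yk z (EuclideanSpace.single i 1)) →
      ∀ t : ℝ, 0 ≤ t → ∀ x : E3,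
        ∫⁻ y : E3,
            ENNReal.ofReal (|g (x - y)| * Real.exp (-(‖y‖ - lam * t) ^ 2 / (D * (1 + t)))) ≤
          ENNReal.ofReal (C * Real.exp (-(‖x‖ - lam * t) ^ 2 / (η ^ 2 * D * (1 + t))) +
            C * Real.exp (-(‖x‖ + t) / (η ^ 2 * D))) := by
  have hη2 : 0 < η ^ 2 - η := by nlinarith
  have hm : 0 < 4 * max 1 lam := by positivity
  have hD0 : 0 < D := (div_pos hm hη2).trans hD
  obtain ⟨κ, hκdef⟩ : ∃ κ, κ = 4 * max 1 lam / ((η ^ 2 - η) * D) := ⟨_, rfl⟩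
  have hκ : κ * ((η ^ 2 - η) * D) = 4 * max 1 lam := by
    rw [hκdef, div_mul_cancel₀ _ (mul_pos hη2 hD0).ne']
  have hκ0 : 0 < κ := by rw [hκdef]; positivity
  have hκ1 : κ < 1 := by
    rw [hκdef, div_lt_one (by positivity)]
    rwa [div_lt_iff₀ hη2, mul_comm D] at hD
  obtain ⟨k, hk⟩ : ∃ k : E3 → ℝ, k = fun z =>
      ((‖z‖ ^ 2)⁻¹ + ‖z‖⁻¹) * Real.exp (-((1 - κ) * ‖z‖)) := ⟨_, rfl⟩
  have hk0 : ∀ z, 0 ≤ k z := fun z => by rw [hk]; positivity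
  have hkint : Integrable k := hk ▸ integrable_inv_sq_add_inv_mul_exp (sub_pos.2 hκ1)
  have hI0 : 0 ≤ ∫ z, k z := integral_nonneg hk0
  refine ⟨(∫ z, k z) + 1, by positivity, fun g hg t ht x => ?_⟩
  have hgle : ∀ z : E3, z ≠ 0 → |g z| ≤ ((‖z‖ ^ 2)⁻¹ + ‖z‖⁻¹) * Real.exp (-‖z‖) := by
    rcases hg with rfl | ⟨i, rfl⟩
    · exact fun z _ => abs_Yk_le z
    · exact fun z hz => abs_fderiv_Yk_single_le hz i
  obtain ⟨M, hM⟩ : ∃ M, M = Real.exp (-(‖x‖ - lam * t) ^ 2 / (η ^ 2 * D * (1 + t))) +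
      Real.exp (-(‖x‖ + t) / (η ^ 2 * D)) := ⟨_, rfl⟩
  have hM0 : 0 ≤ M := by rw [hM]; positivity
  have hae : ∀ᵐ y : E3, y ≠ x := compl_mem_ae_iff.2 (measure_singleton x)
  calc _ ≤ ∫⁻ y : E3, ENNReal.ofReal (k (x - y)) * ENNReal.ofReal M := by
        refine lintegral_mono_ae ?_
        filter_upwards [hae] with y hy
        rw [← ENNReal.ofReal_mul (hk0 _)]
        refine ENNReal.ofReal_le_ofReal ?_
        refine (mul_le_mul_of_nonneg_right (hgle _ (sub_ne_zero.2 hy.symm))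
          (Real.exp_nonneg _)).trans ?_
        rw [hk, hM, mul_assoc, mul_assoc]
        exact mul_le_mul_of_nonneg_left (exp_neg_mul_exp_le hη hD0 hκ0 hκ1 hκ ht
          (norm_nonneg x) (abs_norm_sub_norm_le x y)) (by positivity)
    _ = ENNReal.ofReal ((∫ z, k z) * M) := by
        rw [lintegral_mul_const' _ _ ENNReal.ofReal_ne_top,
          lintegral_sub_left_eq_self (fun z => ENNReal.ofReal (k z)) x,
          ← ofReal_integral_eq_lintegral_ofReal hkint (Filter.Eventually.of_forall hk0),
          ENNReal.ofReal_mul hI0]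
    _ ≤ _ := by
        refine ENNReal.ofReal_le_ofReal ?_
        rw [← mul_add, ← hM]
        exact mul_le_mul_of_nonneg_right (by linarith) hM0

end
end

section
/- Let λ > 0, η > 1 and D > 4·max{1, λ}/(η² − η). There exists a constant C > 0 such that for every t ≥ 0, every x ∈ ℝ³ and every multi-index α ∈ ℕ³ with |α| ≤ 1, ∫_{{|y| ≤ λt}} |∂_x^α(|x−y|^{−1} e^{−|x−y|})| B_{3/2}(t, |y|) dy ≤ C (1+t)^{−3/2} e^{−(|x|−λt)²/(η²D(1+t))} + C e^{−(|x|+t)/(η²D)} + C B_{3/2}(t, |x|) 1_{{|x| ≤ λt}}. -/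
open MeasureTheory Real
open scoped ENNReal

noncomputable section

/-- The space–time diffusive profile `B_k(t,z) = (1 + z²/(1+t))^{-k}`. -/
def Bprof (k t z : ℝ) : ℝ := (1 + z ^ 2 / (1 + t)) ^ (-k)

lemma integrable_inv_sq_mul_exp_norm :
    Integrable (fun z : E3 => (‖z‖ ^ 2)⁻¹ * exp (-‖z‖ / 4)) := by
  have key := (integrable_fun_norm_addHaar (μ := (volume : Measure E3))
    (f := fun r : ℝ => (r ^ 2)⁻¹ * exp (-r / 4))).2
  refine key ?_
  have h : IntegrableOn (fun r : ℝ => exp (-(1 / 4) * r)) (Set.Ioi 0) :=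
    exp_neg_integrableOn_Ioi 0 (by norm_num)
  refine h.congr_fun ?_ measurableSet_Ioi
  intro r hr
  have hr' : r ≠ 0 := (Set.mem_Ioi.1 hr).ne'
  simp only [finrank_euclideanSpace, Fintype.card_fin, smul_eq_mul]
  rw [← mul_assoc, show 3 - 1 = 2 from rfl, mul_inv_cancel₀ (pow_ne_zero 2 hr'), one_mul]
  congr 1
  ring

lemma hasDerivAt_inv_mul_exp_neg {r : ℝ} (hr : r ≠ 0) :
    HasDerivAt (fun s : ℝ => s⁻¹ * exp (-s)) (-(((r ^ 2)⁻¹ + r⁻¹) * exp (-r))) r := by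
  have h1 := hasDerivAt_inv hr
  have h2 := (hasDerivAt_neg r).exp
  refine (h1.mul h2).congr_deriv ?_
  ring

lemma abs_fderiv_Yk_le {z : E3} (hz : z ≠ 0) (v : E3) :
    |fderiv ℝ Yk z v| ≤ ((‖z‖ ^ 2)⁻¹ + ‖z‖⁻¹) * exp (-‖z‖) * ‖v‖ := by
  have hr : ‖z‖ ≠ 0 := norm_ne_zero_iff.2 hz
  have hn : HasFDerivAt (fun z : E3 => ‖z‖) (fderiv ℝ (fun z : E3 => ‖z‖) z) z :=
    ((contDiffAt_norm ℝ hz (n := 1)).differentiableAt (by norm_num)).hasFDerivAt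
  have hY : HasFDerivAt Yk _ z := (hasDerivAt_inv_mul_exp_neg hr).comp_hasFDerivAt z hn
  have hL : ‖fderiv ℝ (fun z : E3 => ‖z‖) z‖ ≤ 1 := by
    simpa using norm_fderiv_le_of_lipschitz ℝ (lipschitzWith_one_norm (E := E3)) (x₀ := z)
  have hv : |fderiv ℝ (fun z : E3 => ‖z‖) z v| ≤ ‖v‖ := by
    simpa using (fderiv ℝ (fun z : E3 => ‖z‖) z).le_of_opNorm_le hL v
  rw [hY.fderiv, smul_apply, smul_eq_mul, abs_mul, abs_neg,
    abs_of_nonneg (by positivity)]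
  gcongr

/-- Peetre-type comparison of the weights at two points. -/
lemma Bprof_le_mul_Bprof {t a b r : ℝ} (ht : 0 ≤ t) (hb : 0 ≤ b) (ha : 0 ≤ a) (hr : 0 ≤ r)
    (hab : b ≤ a + r) :
    Bprof (3 / 2) t a ≤ 4 * (1 + r) ^ 4 * Bprof (3 / 2) t b := by
  have hT : 0 < 1 + t := by linarith
  have hwa : 0 < 1 + a ^ 2 / (1 + t) := by positivity
  have hwb : 0 < 1 + b ^ 2 / (1 + t) := by positivity
  have hq : (1 : ℝ) ≤ 2 * (1 + r) ^ 2 := by nlinarith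
  have hw : 1 + b ^ 2 / (1 + t) ≤ 2 * (1 + r) ^ 2 * (1 + a ^ 2 / (1 + t)) := by
    have h1 : b ^ 2 ≤ 2 * a ^ 2 + 2 * r ^ 2 := by nlinarith [sq_nonneg (a - r)]
    have h2 : b ^ 2 / (1 + t) ≤ 2 * (a ^ 2 / (1 + t)) + 2 * r ^ 2 := by
      rw [div_le_iff₀ hT]
      have : a ^ 2 / (1 + t) * (1 + t) = a ^ 2 := by field_simp
      nlinarith [mul_nonneg (sq_nonneg r) ht]
    have h3 : 0 ≤ a ^ 2 / (1 + t) := by positivity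
    nlinarith [mul_nonneg hr h3, mul_nonneg (sq_nonneg r) h3]
  have hpow : (1 + b ^ 2 / (1 + t)) ^ (3 / 2 : ℝ) ≤
      4 * (1 + r) ^ 4 * (1 + a ^ 2 / (1 + t)) ^ (3 / 2 : ℝ) := by
    calc (1 + b ^ 2 / (1 + t)) ^ (3 / 2 : ℝ)
        ≤ (2 * (1 + r) ^ 2 * (1 + a ^ 2 / (1 + t))) ^ (3 / 2 : ℝ) := by gcongr
      _ = (2 * (1 + r) ^ 2) ^ (3 / 2 : ℝ) * (1 + a ^ 2 / (1 + t)) ^ (3 / 2 : ℝ) :=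
          mul_rpow (by positivity) hwa.le
      _ ≤ (2 * (1 + r) ^ 2) ^ (2 : ℝ) * (1 + a ^ 2 / (1 + t)) ^ (3 / 2 : ℝ) := by
          gcongr
          norm_num
      _ = 4 * (1 + r) ^ 4 * (1 + a ^ 2 / (1 + t)) ^ (3 / 2 : ℝ) := by
          rw [rpow_two]; ring
  unfold Bprof
  rw [rpow_neg hwa.le, rpow_neg hwb.le, ← div_eq_mul_inv, le_div_iff₀ (by positivity),
    inv_mul_le_iff₀ (by positivity)]
  linarith

lemma Bprof_le_one {t z : ℝ} (ht : 0 ≤ t) : Bprof (3 / 2) t z ≤ 1 := by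
  unfold Bprof
  apply rpow_le_one_of_one_le_of_nonpos _ (by norm_num)
  have : 0 ≤ z ^ 2 / (1 + t) := by positivity
  linarith

lemma Bprof_nonneg {k t z : ℝ} (ht : 0 ≤ t) : 0 ≤ Bprof k t z := by
  unfold Bprof
  positivity

/-- Outside the ball of radius `lam * t` the profile decays like `(1 + t)^{-3/2}`. -/
lemma Bprof_le_of_le {lam t z : ℝ} (hlam : 0 < lam) (ht : 0 ≤ t) (hz : lam * t ≤ z) :
    Bprof (3 / 2) t z ≤
      (min 1 (lam ^ 2) / 2) ^ (-(3 : ℝ) / 2) * (1 + t) ^ (-(3 : ℝ) / 2) := by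
  have hT : 0 < 1 + t := by linarith
  have hm : 0 < min 1 (lam ^ 2) := lt_min one_pos (by positivity)
  rw [← mul_rpow (by positivity) hT.le]
  unfold Bprof
  rw [← neg_div]
  apply rpow_le_rpow_of_nonpos (by positivity) _ (by norm_num)
  have hz2 : (lam * t) ^ 2 ≤ z ^ 2 := by gcongr
  have h1 : min 1 (lam ^ 2) ≤ 1 := min_le_left _ _
  have h2 : min 1 (lam ^ 2) ≤ lam ^ 2 := min_le_right _ _
  have h3 : min 1 (lam ^ 2) / 2 * (1 + t) - 1 ≤ z ^ 2 / (1 + t) := by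
    rw [le_div_iff₀ hT]
    nlinarith [mul_nonneg hm.le (sq_nonneg (1 - t)),
      mul_le_mul_of_nonneg_right h2 (sq_nonneg t)]
  linarith

lemma one_add_pow_five_le_exp {r : ℝ} (hr : 0 ≤ r) : (1 + r) ^ 5 ≤ 20 ^ 5 * exp (r / 4) := by
  have h : 1 + r ≤ 20 * exp (r / 20) := by
    have := add_one_le_exp (r / 20)
    linarith
  calc (1 + r) ^ 5 ≤ (20 * exp (r / 20)) ^ 5 := by gcongr
    _ = 20 ^ 5 * exp (r / 4) := by
        rw [mul_pow, ← exp_nat_mul]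
        congr 2
        push_cast
        ring

lemma kernel_mul_Bprof_le {g : E3 → ℝ}
    (hg : g = Yk ∨ ∃ i : Fin 3, g = fun z => fderiv ℝ Yk z (EuclideanSpace.single i 1))
    {t : ℝ} (ht : 0 ≤ t) {x y : E3} (hxy : x - y ≠ 0) :
    |g (x - y)| * Bprof (3 / 2) t ‖y‖ ≤
      4 * 20 ^ 5 * Bprof (3 / 2) t ‖x‖ * exp (-‖x - y‖ / 2) *
        ((‖x - y‖ ^ 2)⁻¹ * exp (-‖x - y‖ / 4)) := by
  have hgb : |g (x - y)| ≤ ((‖x - y‖ ^ 2)⁻¹ + ‖x - y‖⁻¹) * exp (-‖x - y‖) := by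
    rcases hg with rfl | ⟨i, rfl⟩
    · rw [Yk, abs_of_nonneg (by positivity)]
      gcongr
      have : 0 ≤ (‖x - y‖ ^ 2)⁻¹ := by positivity
      linarith
    · simpa using abs_fderiv_Yk_le hxy (EuclideanSpace.single i 1)
  have hB := Bprof_le_mul_Bprof ht (norm_nonneg x) (norm_nonneg y) (norm_nonneg (x - y))
    (by simpa using norm_add_le y (x - y))
  have hr : 0 < ‖x - y‖ := norm_pos_iff.2 hxy
  generalize ‖x - y‖ = r at *
  have hBx : 0 ≤ Bprof (3 / 2) t ‖x‖ := Bprof_nonneg ht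
  have h5 := one_add_pow_five_le_exp hr.le
  calc |g (x - y)| * Bprof (3 / 2) t ‖y‖
      ≤ (((r ^ 2)⁻¹ + r⁻¹) * exp (-r)) * (4 * (1 + r) ^ 4 * Bprof (3 / 2) t ‖x‖) := by
        have := Bprof_nonneg (k := 3 / 2) (z := ‖y‖) ht
        gcongr
    _ = 4 * Bprof (3 / 2) t ‖x‖ * (r ^ 2)⁻¹ * exp (-r) * (1 + r) ^ 5 := by
        field_simp
    _ ≤ 4 * Bprof (3 / 2) t ‖x‖ * (r ^ 2)⁻¹ * exp (-r) * (20 ^ 5 * exp (r / 4)) := by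
        gcongr
    _ = 4 * 20 ^ 5 * Bprof (3 / 2) t ‖x‖ * (r ^ 2)⁻¹ * (exp (-r) * exp (r / 4)) := by ring
    _ = 4 * 20 ^ 5 * Bprof (3 / 2) t ‖x‖ * (r ^ 2)⁻¹ * (exp (-r / 2) * exp (-r / 4)) := by
        rw [← exp_add, ← exp_add]
        congr 2
        ring
    _ = _ := by ring

lemma exists_kernel_mul_Bprof_le : ∃ K > (0 : ℝ), ∀ g : E3 → ℝ,
    (g = Yk ∨ ∃ i : Fin 3, g = fun z => fderiv ℝ Yk z (EuclideanSpace.single i 1)) →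
    ∀ t : ℝ, 0 ≤ t → ∀ x y : E3, x - y ≠ 0 →
      |g (x - y)| * Bprof (3 / 2) t ‖y‖ ≤
        K * Bprof (3 / 2) t ‖x‖ * exp (-‖x - y‖ / 2) *
          ((‖x - y‖ ^ 2)⁻¹ * exp (-‖x - y‖ / 4)) :=
  ⟨4 * 20 ^ 5, by norm_num, fun _ hg _ ht _ _ hxy => kernel_mul_Bprof_le hg ht hxy⟩

lemma setLIntegral_le_of_le_mul_kernel {S : Set E3} (hS : MeasurableSet S) {F : E3 → ℝ} {A : ℝ}
    (hA : 0 ≤ A) {x : E3}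
    (h : ∀ y ∈ S, y ≠ x → F y ≤ A * ((‖x - y‖ ^ 2)⁻¹ * exp (-‖x - y‖ / 4))) :
    ∫⁻ y in S, ENNReal.ofReal (F y) ≤
      ENNReal.ofReal (A * ∫ z : E3, (‖z‖ ^ 2)⁻¹ * exp (-‖z‖ / 4)) := by
  have hne : ∀ᵐ y : E3, y ≠ x := by
    simp [ae_iff]
  calc ∫⁻ y in S, ENNReal.ofReal (F y)
      ≤ ∫⁻ y in S, ENNReal.ofReal (A * ((‖x - y‖ ^ 2)⁻¹ * exp (-‖x - y‖ / 4))) := by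
        apply setLIntegral_mono_ae' hS
        filter_upwards [hne] with y hy hyS
        exact ENNReal.ofReal_le_ofReal (h y hyS hy)
    _ ≤ ∫⁻ y, ENNReal.ofReal (A * ((‖x - y‖ ^ 2)⁻¹ * exp (-‖x - y‖ / 4))) :=
        setLIntegral_le_lintegral _ _
    _ = ∫⁻ z : E3, ENNReal.ofReal (A * ((‖z‖ ^ 2)⁻¹ * exp (-‖z‖ / 4))) :=
        lintegral_sub_left_eq_self
          (fun z : E3 => ENNReal.ofReal (A * ((‖z‖ ^ 2)⁻¹ * exp (-‖z‖ / 4)))) x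
    _ = ENNReal.ofReal (A * ∫ z : E3, (‖z‖ ^ 2)⁻¹ * exp (-‖z‖ / 4)) := by
        rw [← integral_const_mul, ofReal_integral_eq_lintegral_ofReal]
        · exact integrable_inv_sq_mul_exp_norm.const_mul A
        · exact Filter.Eventually.of_forall fun z => by positivity

lemma four_mul_max_lt_sq_mul {lam η D : ℝ} (hη : 1 < η)
    (hD : 4 * max 1 lam / (η ^ 2 - η) < D) : 4 * max 1 lam < η ^ 2 * D := by
  have hm : 1 ≤ max 1 lam := le_max_left _ _
  have hη2 : 0 < η ^ 2 - η := by nlinarith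
  have hD0 : 0 < D := lt_of_le_of_lt (by positivity) hD
  rw [div_lt_iff₀ hη2] at hD
  nlinarith

/-- For `M > 4 max{1, λ}`, the tail `e^{-d/2}` is dominated either by the Gaussian around the
cone or by the exponential in space-time. -/
lemma half_tail_dichotomy {lam M t d : ℝ} (hM : 4 * max 1 lam < M) (ht : 0 ≤ t)
    (hd : 0 ≤ d) :
    d ^ 2 / (M * (1 + t)) ≤ d / 2 ∨ (d + lam * t + t) / M ≤ d / 2 := by
  have h1 : 1 ≤ max 1 lam := le_max_left _ _
  have h2 : lam ≤ max 1 lam := le_max_right _ _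
  have hM0 : 0 < M := by linarith
  rcases le_total (2 * d) (M * (1 + t)) with h | h
  · left
    rw [div_le_iff₀ (by positivity)]
    nlinarith
  · right
    rw [div_le_iff₀ hM0]
    nlinarith [mul_le_mul_of_nonneg_right h2 ht, mul_nonneg ht (sub_nonneg.2 hM.le)]

/-- For `λ > 0`, `η > 1` and `D > 4 max{1,λ}/(η²-η)` there is `C > 0` such that for every
derivative `∂_x^α` of the kernel `|z|⁻¹ e^{-|z|}` of order `|α| ≤ 1`, all `t ≥ 0`, `x ∈ ℝ³`,
`∫_{|y|≤λt} |∂_x^α(|x-y|⁻¹ e^{-|x-y|})| B_{3/2}(t,|y|) dy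
  ≤ C (1+t)^{-3/2} e^{-(|x|-λt)²/(η²D(1+t))} + C e^{-(|x|+t)/(η²D)}
    + C B_{3/2}(t,|x|) 1_{|x|≤λt}`. -/
theorem yukawa_kernel_diffusive_conv (lam η D : ℝ) (hlam : 0 < lam) (hη : 1 < η)
    (hD : 4 * max 1 lam / (η ^ 2 - η) < D) :
    ∃ C > (0 : ℝ), ∀ g : E3 → ℝ,
      (g = Yk ∨ ∃ i : Fin 3, g = fun z => fderiv ℝ Yk z (EuclideanSpace.single i 1)) →
      ∀ t : ℝ, 0 ≤ t → ∀ x : E3,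
        ∫⁻ y in {y : E3 | ‖y‖ ≤ lam * t},
            ENNReal.ofReal (|g (x - y)| * Bprof (3 / 2) t ‖y‖) ≤
          ENNReal.ofReal
            (C * (1 + t) ^ (-(3 : ℝ) / 2) *
                Real.exp (-(‖x‖ - lam * t) ^ 2 / (η ^ 2 * D * (1 + t))) +
              C * Real.exp (-(‖x‖ + t) / (η ^ 2 * D)) +
              C * (if ‖x‖ ≤ lam * t then Bprof (3 / 2) t ‖x‖ else 0)) := by
  obtain ⟨K, hK0, hK⟩ := exists_kernel_mul_Bprof_le
  have hM := four_mul_max_lt_sq_mul hη hD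
  set M := η ^ 2 * D
  set I := ∫ z : E3, (‖z‖ ^ 2)⁻¹ * exp (-‖z‖ / 4) with hI
  have hI0 : 0 ≤ I := integral_nonneg fun z => by positivity
  set c := (min 1 (lam ^ 2) / 2) ^ (-(3 : ℝ) / 2) with hc
  have hc0 : 0 ≤ c := by positivity
  have hK1 : K * I ≤ K * (I + 1) * (1 + c) := by
    nlinarith [mul_nonneg hK0.le (mul_nonneg hI0 hc0), mul_nonneg hK0.le hI0,
      mul_nonneg hK0.le hc0]
  have hKc : K * I * c ≤ K * (I + 1) * (1 + c) := by
    nlinarith [mul_nonneg hK0.le (mul_nonneg hI0 hc0), mul_nonneg hK0.le hI0,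
      mul_nonneg hK0.le hc0]
  refine ⟨K * (I + 1) * (1 + c), by positivity, ?_⟩
  set C := K * (I + 1) * (1 + c)
  have hC0 : 0 ≤ C := by positivity
  clear_value C c I M
  intro g hg t ht x
  have hT : 0 < 1 + t := by linarith
  have hS : MeasurableSet {y : E3 | ‖y‖ ≤ lam * t} := measurableSet_le measurable_norm (by fun_prop)
  have hBx : 0 ≤ Bprof (3 / 2) t ‖x‖ := Bprof_nonneg ht
  have h1 : 0 ≤ C * (1 + t) ^ (-(3 : ℝ) / 2) *
      exp (-(‖x‖ - lam * t) ^ 2 / (M * (1 + t))) := by positivity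
  have h2 : 0 ≤ C * exp (-(‖x‖ + t) / M) := by positivity
  by_cases hx : ‖x‖ ≤ lam * t
  · rw [if_pos hx]
    refine (setLIntegral_le_of_le_mul_kernel hS (x := x)
      (A := K * Bprof (3 / 2) t ‖x‖) (by positivity) ?_).trans
      (ENNReal.ofReal_le_ofReal ?_)
    · intro y _ hyx
      refine (hK g hg t ht x y (sub_ne_zero.2 hyx.symm)).trans ?_
      have hexp : exp (-‖x - y‖ / 2) ≤ 1 :=
        exp_le_one_iff.2 (by linarith [norm_nonneg (x - y)])
      have := mul_le_of_le_one_right (mul_nonneg hK0.le hBx) hexp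
      gcongr
    · rw [← hI]
      linarith [mul_le_mul_of_nonneg_right hK1 hBx]
  · rw [if_neg hx, mul_zero, add_zero]
    rw [not_le] at hx
    refine (setLIntegral_le_of_le_mul_kernel hS (x := x)
      (A := K * Bprof (3 / 2) t ‖x‖ * exp (-(‖x‖ - lam * t) / 2)) (by positivity)
      ?_).trans (ENNReal.ofReal_le_ofReal ?_)
    · intro y hy hyx
      refine (hK g hg t ht x y (sub_ne_zero.2 hyx.symm)).trans ?_
      have hy' : ‖y‖ ≤ lam * t := hy
      have := norm_sub_norm_le x y
      gcongr
      linarith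
    · rw [← hI]
      rcases half_tail_dichotomy hM ht (sub_nonneg.2 hx.le) with h | h
      · have hE : exp (-(‖x‖ - lam * t) / 2) ≤
            exp (-(‖x‖ - lam * t) ^ 2 / (M * (1 + t))) := by
          apply exp_le_exp.2
          rw [neg_div, neg_div]
          exact neg_le_neg h
        have hB := Bprof_le_of_le hlam ht hx.le
        rw [← hc] at hB
        calc K * Bprof (3 / 2) t ‖x‖ * exp (-(‖x‖ - lam * t) / 2) * I
            ≤ K * (c * (1 + t) ^ (-(3 : ℝ) / 2)) *
                exp (-(‖x‖ - lam * t) ^ 2 / (M * (1 + t))) * I := by gcongr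
          _ = K * I * c * (1 + t) ^ (-(3 : ℝ) / 2) *
                exp (-(‖x‖ - lam * t) ^ 2 / (M * (1 + t))) := by ring
          _ ≤ C * (1 + t) ^ (-(3 : ℝ) / 2) *
                exp (-(‖x‖ - lam * t) ^ 2 / (M * (1 + t))) := by gcongr
          _ ≤ _ := le_add_of_nonneg_right h2
      · have hE : exp (-(‖x‖ - lam * t) / 2) ≤ exp (-(‖x‖ + t) / M) := by
          apply exp_le_exp.2
          rw [neg_div, neg_div]
          rw [sub_add_cancel] at h
          exact neg_le_neg h
        calc K * Bprof (3 / 2) t ‖x‖ * exp (-(‖x‖ - lam * t) / 2) * I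
            ≤ K * 1 * exp (-(‖x‖ + t) / M) * I := by
              gcongr
              exact Bprof_le_one ht
          _ = K * I * exp (-(‖x‖ + t) / M) := by ring
          _ ≤ C * exp (-(‖x‖ + t) / M) := by gcongr
          _ ≤ _ := le_add_of_nonneg_left h1


end
end
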